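/- Let X be a real Banach space with the strong diameter two property (SD2P) and let Y be a two-dimensional real Banach space. Then the projective tensor product X ⊗_π Y has the SD2P. -/

import Mathlib

open scoped TensorProduct

universe v

/-- The projective norm of an element of the algebraic tensor product of two normed
spaces: the infimum of `Σ ‖eᵢ‖ ‖fᵢ‖` over all finite representations `u = Σ eᵢ ⊗ fᵢ`. -/
noncomputable def projNorm (E F : Type*) [NormedAddCommGroup E] [NormedAddCommGroup F]
    [NormedSpace ℝ E] [NormedSpace ℝ F] (u : E ⊗[ℝ] F) : ℝ :=
  sInf {s : ℝ | ∃ (n : ℕ) (e : Fin n → E) (f : Fin n → F),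
    u = ∑ i, e i ⊗ₜ[ℝ] f i ∧ s = ∑ i, ‖e i‖ * ‖f i‖}

/-- `Z`, together with the bilinear map `t : E → F → Z`, is (a realization of) the
projective tensor product `E ⊗̂_π F`: the induced linear map `E ⊗ F → Z` is injective
with dense range, and it is an isometry when `E ⊗ F` carries the projective norm. -/
def IsProjectiveTensorProduct (E F Z : Type*) [NormedAddCommGroup E] [NormedAddCommGroup F]
    [NormedAddCommGroup Z] [NormedSpace ℝ E] [NormedSpace ℝ F] [NormedSpace ℝ Z]
    (t : E →ₗ[ℝ] F →ₗ[ℝ] Z) : Prop :=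
  Function.Injective (TensorProduct.lift t) ∧ DenseRange (TensorProduct.lift t) ∧
    ∀ u : E ⊗[ℝ] F, ‖TensorProduct.lift t u‖ = projNorm E F u

/-- A Banach space has the strong diameter two property (SD2P) if every convex
combination of slices of its unit ball has diameter two. -/
def SD2P (Z : Type*) [NormedAddCommGroup Z] [NormedSpace ℝ Z] : Prop :=
  ∀ (n : ℕ) (f : Fin n → Z →L[ℝ] ℝ) (a : Fin n → ℝ) (l : Fin n → ℝ),
    (∀ i, f i ≠ 0) → (∀ i, 0 < a i) → (∀ i, 0 ≤ l i) → ∑ i, l i = 1 →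
    Metric.diam {z : Z | ∃ g : Fin n → Z,
      (∀ i, ‖g i‖ ≤ 1 ∧ f i (g i) > ‖f i‖ - a i) ∧ z = ∑ i, l i • g i} = 2

lemma pl_aux (S : Finset (ℝ × ℝ)) : S.Nonempty →
    ∃ (κ : Type) (_ : Fintype κ) (c σ : κ → ℝ) (A B : ℝ), (∀ k, 0 ≤ c k) ∧
      (∀ α, (∀ p ∈ S, p.1 ≤ α) → B + ∑ k, c k ≤ α) ∧
      ∀ s, (∀ p ∈ S, p.1 * s + p.2 ≤ A + B * s + ∑ k, c k * max (s - σ k) 0) ∧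
        ∃ p ∈ S, A + B * s + ∑ k, c k * max (s - σ k) 0 = p.1 * s + p.2 := by
  classical
  induction S using Finset.induction_on_max_value (fun p : ℝ × ℝ => p.1) with
  | empty => intro h; simp at h
  | insert q S hq hmax ih =>
    intro _
    obtain ⟨α, β⟩ := q
    rcases S.eq_empty_or_nonempty with rfl | hne
    · refine ⟨Empty, inferInstance, fun _ => 0, fun _ => 0, β, α, by simp, ?_, ?_⟩
      · intro a ha
        simpa using ha (α, β) (by simp)
      · intro s
        simp [add_comm]
    obtain ⟨κ, _, c, σ, A, B, hc, hsl, hH⟩ := ih hne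
    have hα : B + ∑ k, c k ≤ α := hsl α (fun p hp => hmax p hp)
    set H : ℝ → ℝ := fun s => A + B * s + ∑ k, c k * max (s - σ k) 0 with hHdef
    have hcont : Continuous (fun s => H s - (α * s + β)) := by
      simp only [hHdef]; fun_prop
    have hanti : ∀ s s', s ≤ s' → H s' - (α * s' + β) ≤ H s - (α * s + β) := by
      intro s s' h
      have h1 : ∑ k, c k * max (s' - σ k) 0 ≤ ∑ k, (c k * max (s - σ k) 0 + c k * (s' - s)) := by
        refine Finset.sum_le_sum fun k _ => ?_
        rw [← mul_add]
        refine mul_le_mul_of_nonneg_left ?_ (hc k)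
        rcases max_cases (s' - σ k) 0 with h | h <;> rcases max_cases (s - σ k) 0 with h' | h' <;>
          linarith
      rw [Finset.sum_add_distrib, ← Finset.sum_mul] at h1
      simp only [hHdef]
      nlinarith [mul_le_mul_of_nonneg_right hα (sub_nonneg.2 h)]
    by_cases h1 : ∀ s, 0 ≤ H s - (α * s + β)
    · refine ⟨κ, inferInstance, c, σ, A, B, hc, ?_, ?_⟩
      · intro a ha
        exact hsl a (fun p hp => ha p (Finset.mem_insert_of_mem hp))
      · intro s
        refine ⟨?_, ?_⟩
        · intro p hp
          rcases Finset.mem_insert.1 hp with rfl | hp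
          · have := h1 s
            simp only [hHdef] at this
            simp only
            linarith
          · exact (hH s).1 p hp
        · obtain ⟨p, hp, h⟩ := (hH s).2
          exact ⟨p, Finset.mem_insert_of_mem hp, h⟩
    by_cases h2 : ∀ s, H s - (α * s + β) < 0
    · refine ⟨Empty, inferInstance, fun _ => 0, fun _ => 0, β, α, by simp, ?_, ?_⟩
      · intro a ha
        simpa using ha (α, β) (by simp)
      · intro s
        refine ⟨?_, (α, β), by simp, by simp [add_comm]⟩
        intro p hp
        rcases Finset.mem_insert.1 hp with rfl | hp
        · simp [add_comm]
        · have := (hH s).1 p hp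
          have h3 := h2 s
          simp only [hHdef] at h3
          simp
          linarith
    push Not at h1 h2
    obtain ⟨u, hu⟩ := h1
    obtain ⟨w, hw⟩ := h2
    obtain ⟨z, hz⟩ : ∃ z, H z - (α * z + β) = 0 :=
      mem_range_of_exists_le_of_exists_ge hcont ⟨u, hu.le⟩ ⟨w, hw⟩
    set c' : κ → ℝ := fun k => if σ k < z then c k else 0 with hc'
    have hc'le : ∀ k, c' k ≤ c k := by
      intro k; simp only [hc']; split_ifs
      · exact le_rfl
      · exact hc k
    have hc'0 : ∀ k, 0 ≤ c' k := by
      intro k; simp only [hc']; split_ifs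
      · exact hc k
      · exact le_rfl
    have hsum : ∑ k, c' k ≤ ∑ k, c k := Finset.sum_le_sum fun k _ => hc'le k
    have hleft : ∀ s, s ≤ z → A + B * s + ∑ k, c' k * max (s - σ k) 0 = H s := by
      intro s hs
      simp only [hHdef]
      congr 1
      refine Finset.sum_congr rfl fun k _ => ?_
      simp only [hc']
      split_ifs with h
      · rfl
      · rw [max_eq_right (by linarith)]; simp
    have hright : ∀ s, z ≤ s → A + B * s + ∑ k, c' k * max (s - σ k) 0
        + (α - B - ∑ k, c' k) * (s - z) = α * s + β := by
      intro s hs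
      have e1 : ∑ k, c' k * max (s - σ k) 0 = ∑ k, (c' k * max (z - σ k) 0 + c' k * (s - z)) := by
        refine Finset.sum_congr rfl fun k _ => ?_
        simp only [hc']
        split_ifs with h
        · rw [max_eq_left (by linarith), max_eq_left (by linarith)]; ring
        · simp
      rw [Finset.sum_add_distrib, ← Finset.sum_mul] at e1
      have e2 := hleft z le_rfl
      rw [e1]
      linear_combination e2 + hz
    have hval : ∀ s, A + B * s + ∑ k : Option κ, (k.elim (α - B - ∑ k, c' k) c') *
        max (s - k.elim z σ) 0 = if s ≤ z then H s else α * s + β := by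
      intro s
      rw [Fintype.sum_option]
      simp only [Option.elim]
      split_ifs with h
      · rw [max_eq_right (by linarith : s - z ≤ 0), ← hleft s h]; ring
      · push Not at h
        rw [max_eq_left (by linarith : 0 ≤ s - z), ← hright s h.le]; ring
    refine ⟨Option κ, inferInstance, fun k => k.elim (α - B - ∑ k, c' k) c',
      fun k => k.elim z σ, A, B, ?_, ?_, ?_⟩
    · rintro (_ | k)
      · simp only [Option.elim]; linarith
      · exact hc'0 k
    · intro a ha
      rw [Fintype.sum_option]
      simp only [Option.elim]
      have := ha (α, β) (by simp)
      simp only at this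
      linarith
    · intro s
      rw [hval s]
      split_ifs with h
      · have h3 := hanti s z h
        refine ⟨?_, ?_⟩
        · intro p hp
          rcases Finset.mem_insert.1 hp with rfl | hp
          · simp only; linarith
          · exact (hH s).1 p hp
        · obtain ⟨p, hp, h⟩ := (hH s).2
          exact ⟨p, Finset.mem_insert_of_mem hp, h⟩
      · push Not at h
        have h3 := hanti z s h.le
        refine ⟨?_, (α, β), by simp, rfl⟩
        intro p hp
        rcases Finset.mem_insert.1 hp with rfl | hp
        · exact le_rfl
        · have : p.1 * s + p.2 ≤ H s := (hH s).1 p hp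
          linarith

lemma slope_zero {d e r : ℝ} (h : ∀ s, r ≤ s → |d * s| ≤ e) : d = 0 := by
  by_contra hd
  have hd' : 0 < |d| := abs_pos.2 hd
  have h1 := h (max r (max ((e + 1) / |d|) 0)) (le_max_left _ _)
  set s := max r (max ((e + 1) / |d|) 0)
  have hs : (e + 1) / |d| ≤ s := (le_max_left _ _).trans (le_max_right _ _)
  have hs0 : 0 ≤ s := (le_max_right _ _).trans (le_max_right _ _)
  rw [abs_mul, abs_of_nonneg hs0] at h1
  rw [div_le_iff₀ hd'] at hs
  linarith

lemma zonotope_aux {ι : Type*} [Fintype ι] [Nonempty ι] (a b : ι → ℝ) :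
    ∃ (κ : Type) (_ : Fintype κ) (p q : κ → ℝ), ∀ x y : ℝ,
      (∀ i, |a i * y + b i * x| ≤ ∑ k, |p k * y + q k * x|) ∧
      ∃ i, ∑ k, |p k * y + q k * x| = |a i * y + b i * x| := by
  classical
  let S : Finset (ℝ × ℝ) := Finset.univ.image (fun i => (a i, b i)) ∪
    Finset.univ.image (fun i => (-a i, -b i))
  have hS1 : ∀ i, (a i, b i) ∈ S := fun i =>
    Finset.mem_union_left _ (Finset.mem_image_of_mem (fun i => (a i, b i)) (Finset.mem_univ i))
  have hS2 : ∀ i, (-a i, -b i) ∈ S := fun i =>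
    Finset.mem_union_right _ (Finset.mem_image_of_mem (fun i => (-a i, -b i)) (Finset.mem_univ i))
  have hS3 : ∀ p ∈ S, ∃ i, p = (a i, b i) ∨ p = (-a i, -b i) := by
    intro p hp
    simp only [S, Finset.mem_union, Finset.mem_image, Finset.mem_univ, true_and] at hp
    rcases hp with ⟨i, rfl⟩ | ⟨i, rfl⟩
    · exact ⟨i, Or.inl rfl⟩
    · exact ⟨i, Or.inr rfl⟩
  obtain ⟨κ, _, c, σ, A, B, hc, -, hH⟩ := pl_aux S ⟨_, hS1 (Classical.arbitrary ι)⟩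
  set H : ℝ → ℝ := fun s => A + B * s + ∑ k, c k * max (s - σ k) 0 with hHdef
  have hge : ∀ s i, |a i * s + b i| ≤ H s := by
    intro s i
    have h1 := (hH s).1 _ (hS1 i)
    have h2 := (hH s).1 _ (hS2 i)
    simp only at h1 h2
    rw [abs_le]; simp only [hHdef]
    constructor <;> linarith
  have hex : ∀ s, ∃ i, H s = |a i * s + b i| := by
    intro s
    obtain ⟨p, hp, h⟩ := (hH s).2
    change H s = _ at h
    obtain ⟨i, rfl | rfl⟩ := hS3 p hp
    · refine ⟨i, le_antisymm ?_ (hge s i)⟩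
      rw [h]; exact le_abs_self _
    · refine ⟨i, le_antisymm ?_ (hge s i)⟩
      rw [h]; simp only
      rw [← abs_neg]
      refine le_trans (le_of_eq ?_) (le_abs_self _); ring
  obtain ⟨i₀, hi₀⟩ := Finite.exists_max (fun i => |a i|)
  obtain ⟨j₀, hj₀⟩ := Finite.exists_max (fun i => |b i|)
  set M := |a i₀| with hM
  set N := |b j₀| with hN
  have hup : ∀ s, H s ≤ M * |s| + N := by
    intro s
    obtain ⟨i, hi⟩ := hex s
    rw [hi]
    calc |a i * s + b i| ≤ |a i * s| + |b i| := abs_add_le _ _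
      _ ≤ M * |s| + N := by
        rw [abs_mul]
        gcongr
        · exact hi₀ i
        · exact hj₀ i
  have hlo : ∀ s, M * |s| - N ≤ H s := by
    intro s
    have h1 := hge s i₀
    have h2 : |a i₀ * s| ≤ |a i₀ * s + b i₀| + |b i₀| := by
      have := abs_sub (a i₀ * s + b i₀) (b i₀)
      simpa using this
    rw [abs_mul] at h2
    have := hj₀ i₀
    linarith
  set C := ∑ k, c k with hC
  set D := ∑ k, c k * σ k with hD
  set R := ∑ k, |σ k| with hR
  have hσ : ∀ k, |σ k| ≤ R := fun k =>
    Finset.single_le_sum (f := fun k => |σ k|) (fun k _ => abs_nonneg _) (Finset.mem_univ k)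
  have hR0 : 0 ≤ R := Finset.sum_nonneg fun k _ => abs_nonneg _
  have hpos : ∀ s, R ≤ s → H s = A + B * s + C * s - D := by
    intro s hs
    have : ∑ k, c k * max (s - σ k) 0 = ∑ k, (c k * s - c k * σ k) := by
      refine Finset.sum_congr rfl fun k _ => ?_
      have := (abs_le.1 (hσ k)).2
      rw [max_eq_left (by linarith)]; ring
    rw [Finset.sum_sub_distrib, ← Finset.sum_mul] at this
    simp only [hHdef, this]; ring
  have hneg : ∀ s, R ≤ s → H (-s) = A - B * s := by
    intro s hs
    have : ∑ k, c k * max (-s - σ k) 0 = 0 := by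
      refine Finset.sum_eq_zero fun k _ => ?_
      have := (abs_le.1 (hσ k)).1
      rw [max_eq_right (by linarith)]; ring
    simp only [hHdef, this]; ring
  have hBC : B + C - M = 0 := by
    refine slope_zero (e := N + |A - D|) (r := R) ?_
    intro s hs
    have h1 := hup s
    have h2 := hlo s
    rw [hpos s hs, abs_of_nonneg (hR0.trans hs)] at h1 h2
    have h3 := abs_le.1 (le_refl |A - D|)
    rw [abs_le]
    constructor <;> nlinarith
  have hB : -B - M = 0 := by
    refine slope_zero (e := N + |A|) (r := R) ?_
    intro s hs
    have h1 := hup (-s)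
    have h2 := hlo (-s)
    rw [hneg s hs, abs_neg, abs_of_nonneg (hR0.trans hs)] at h1 h2
    have h3 := abs_le.1 (le_refl |A|)
    rw [abs_le]
    constructor <;> nlinarith
  have hA : 0 ≤ 2 * A - D := by
    have h1 := hge R i₀
    have h2 := hge (-R) i₀
    rw [hpos R le_rfl] at h1
    rw [hneg R le_rfl] at h2
    have h3 := abs_sub (a i₀ * R + b i₀) (a i₀ * -R + b i₀)
    have h4 : a i₀ * R + b i₀ - (a i₀ * -R + b i₀) = a i₀ * (2 * R) := by ring
    rw [h4, abs_mul, abs_of_nonneg (by linarith : 0 ≤ 2 * R)] at h3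
    have h5 : C = 2 * M := by linarith
    have h6 : B = - M := by linarith
    rw [h5, h6] at h1
    rw [h6] at h2
    nlinarith
  have hform : ∀ s, H s = ∑ k, |c k / 2 * s - c k / 2 * σ k| + |A - D / 2| := by
    intro s
    rw [abs_of_nonneg (by linarith : 0 ≤ A - D / 2)]
    have : ∑ k, c k * max (s - σ k) 0 =
        ∑ k, (|c k / 2 * s - c k / 2 * σ k| + (c k * s / 2 - c k * σ k / 2)) := by
      refine Finset.sum_congr rfl fun k _ => ?_
      rw [← mul_sub, abs_mul, abs_of_nonneg (by linarith [hc k] : 0 ≤ c k / 2)]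
      rcases le_total 0 (s - σ k) with h | h
      · rw [max_eq_left h, abs_of_nonneg h]; ring
      · rw [max_eq_right h, abs_of_nonpos h]; ring
    rw [Finset.sum_add_distrib, Finset.sum_sub_distrib, ← Finset.sum_div, ← Finset.sum_div,
      ← Finset.sum_mul] at this
    simp only [hHdef, this]
    linear_combination (s / 2) * (hBC - hB)
  refine ⟨Option κ, inferInstance, fun k => k.elim 0 (fun k => c k / 2),
    fun k => k.elim (A - D / 2) (fun k => - (c k / 2 * σ k)), ?_⟩
  intro x y
  rw [Fintype.sum_option]
  simp only [Option.elim]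
  by_cases hx : x = 0
  · subst hx
    have e : |0 * y + (A - D / 2) * 0| + ∑ k, |c k / 2 * y + -(c k / 2 * σ k) * 0| = M * |y| := by
      have : ∑ k, |c k / 2 * y + -(c k / 2 * σ k) * 0| = ∑ k, c k * (|y| / 2) := by
        refine Finset.sum_congr rfl fun k _ => ?_
        rw [mul_zero, add_zero, abs_mul, abs_of_nonneg (by linarith [hc k] : 0 ≤ c k / 2)]
        ring
      rw [this, ← Finset.sum_mul]
      simp
      linear_combination (|y| / 2) * (hBC + hB)
    rw [e]
    refine ⟨fun i => ?_, i₀, ?_⟩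
    · rw [mul_zero, add_zero, abs_mul]
      exact mul_le_mul_of_nonneg_right (hi₀ i) (abs_nonneg _)
    · rw [mul_zero, add_zero, abs_mul]
  · have hax : 0 < |x| := abs_pos.2 hx
    have e : |0 * y + (A - D / 2) * x| + ∑ k, |c k / 2 * y + -(c k / 2 * σ k) * x|
        = H (y / x) * |x| := by
      rw [hform, add_mul, Finset.sum_mul, ← abs_mul, add_comm]
      congr 1
      · refine Finset.sum_congr rfl fun k _ => ?_
        rw [← abs_mul]
        congr 1
        field_simp
        ring
      · simp
    have e' : ∀ i, |a i * y + b i * x| = |a i * (y / x) + b i| * |x| := by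
      intro i
      rw [← abs_mul]
      congr 1
      field_simp
    rw [e]
    refine ⟨fun i => ?_, ?_⟩
    · rw [e']
      exact mul_le_mul_of_nonneg_right (hge _ i) hax.le
    · obtain ⟨i, hi⟩ := hex (y / x)
      exact ⟨i, by rw [e', hi]⟩

lemma zonotope_dual {Y : Type*} [NormedAddCommGroup Y] [NormedSpace ℝ Y]
    (hY : Module.finrank ℝ Y = 2) {ι : Type*} [Fintype ι] [Nonempty ι] (f : ι → Y →ₗ[ℝ] ℝ) :
    ∃ (m : ℕ) (φ : Fin m → Y →ₗ[ℝ] ℝ), ∀ y : Y,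
      (∀ i, |f i y| ≤ ∑ k, |φ k y|) ∧ ∃ i, ∑ k, |φ k y| = |f i y| := by
  have : FiniteDimensional ℝ Y := Module.finite_of_finrank_eq_succ hY
  let e := Module.finBasisOfFinrankEq ℝ Y hY
  obtain ⟨κ, _, p, q, h⟩ := zonotope_aux (fun i => f i (e 0)) (fun i => f i (e 1))
  let ψ : κ → Y →ₗ[ℝ] ℝ := fun k => p k • e.coord 0 + q k • e.coord 1
  refine ⟨Fintype.card κ, fun k => ψ ((Fintype.equivFin κ).symm k), ?_⟩
  intro y
  have h1 : ∑ k, |ψ ((Fintype.equivFin κ).symm k) y| = ∑ k, |ψ k y| :=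
    (Fintype.equivFin κ).symm.sum_comp (fun k => |ψ k y|)
  rw [h1]
  have h2 : ∀ i, f i y = f i (e 0) * e.coord 0 y + f i (e 1) * e.coord 1 y := by
    intro i
    have h4 := congrArg (f i) (e.sum_repr y)
    rw [← h4, map_sum, Fin.sum_univ_two]
    simp only [map_smul, smul_eq_mul, Module.Basis.coord_apply, mul_comm]
  have h3 := h (e.coord 1 y) (e.coord 0 y)
  simp only [h2]
  simpa [ψ] using h3

lemma sd2p_step {X : Type*} [NormedAddCommGroup X] [NormedSpace ℝ X] (hX : SD2P X)
    {ι : Type*} [Fintype ι] [Nonempty ι] (F : ι → X →L[ℝ] ℝ) (hF : ∀ i, F i ≠ 0)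
    (δ : ℝ) (hδ : 0 < δ) :
    ∃ g : X →L[ℝ] ℝ, ‖g‖ ≤ 1 ∧ ∀ i, (∃ x, ‖x‖ ≤ 1 ∧ F i x > ‖F i‖ - δ ∧ g x > 1 - δ) ∧
      (∃ x, ‖x‖ ≤ 1 ∧ F i x > ‖F i‖ - δ ∧ - g x > 1 - δ) := by
  classical
  set n := Fintype.card ι with hn
  have hn0 : (0 : ℝ) < n := by exact_mod_cast Fintype.card_pos
  let e := Fintype.equivFin ι
  have hd := hX n (fun k => F (e.symm k)) (fun _ => δ) (fun _ => 1 / n) (fun k => hF _)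
    (fun _ => hδ) (fun _ => by positivity) (by simp [hn0.ne'])
  have : ∃ u v : Fin n → X, (∀ k, ‖u k‖ ≤ 1 ∧ F (e.symm k) (u k) > ‖F (e.symm k)‖ - δ) ∧
      (∀ k, ‖v k‖ ≤ 1 ∧ F (e.symm k) (v k) > ‖F (e.symm k)‖ - δ) ∧
      max (2 - δ / n) 0 < dist (∑ k, (1 / n : ℝ) • u k) (∑ k, (1 / n : ℝ) • v k) := by
    by_contra! hcon
    have := Metric.diam_le_of_forall_dist_le (le_max_right (2 - δ / n) 0) (s := {z : X | ∃ g : Fin n → X,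
      (∀ i, ‖g i‖ ≤ 1 ∧ F (e.symm i) (g i) > ‖F (e.symm i)‖ - δ) ∧ z = ∑ i, (1 / n : ℝ) • g i}) (by
        rintro _ ⟨u, hu, rfl⟩ _ ⟨v, hv, rfl⟩
        exact hcon u v hu hv)
    rw [hd] at this
    have h2 : 0 < δ / n := by positivity
    rcases le_max_iff.1 this with h | h <;> linarith
  obtain ⟨u, v, hu, hv, huv⟩ := this
  obtain ⟨g, hg1, hg2⟩ := exists_dual_vector'' ℝ ((∑ k, (1 / n : ℝ) • u k) - (∑ k, (1 / n : ℝ) • v k))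
  rw [dist_eq_norm] at huv
  have huv' := lt_of_le_of_lt (le_max_left _ _) huv
  have hg3 : g ((∑ k, (1 / n : ℝ) • u k) - (∑ k, (1 / n : ℝ) • v k)) =
      (1 / n) * ∑ k, (g (u k) - g (v k)) := by
    rw [← Finset.smul_sum, ← Finset.smul_sum, ← smul_sub, map_smul, map_sub, map_sum, map_sum,
      Finset.sum_sub_distrib, smul_eq_mul]
  have hle : ∀ x, ‖x‖ ≤ 1 → |g x| ≤ 1 := by
    intro x hx
    have := g.le_opNorm x
    rw [Real.norm_eq_abs] at this
    nlinarith [norm_nonneg x, norm_nonneg g]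
  have hsum : 2 * n - δ < ∑ k, (g (u k) - g (v k)) := by
    have : 2 - δ / n < (1 / n) * ∑ k, (g (u k) - g (v k)) := by
      rw [← hg3, hg2]; exact huv'
    have h2 := mul_lt_mul_of_pos_left this hn0
    have h3 : (n : ℝ) * (2 - δ / n) = 2 * n - δ := by field_simp
    have h4 : (n : ℝ) * ((1 / n) * ∑ k, (g (u k) - g (v k))) = ∑ k, (g (u k) - g (v k)) := by
      field_simp
    linarith
  have hk : ∀ k, 2 - δ < g (u k) - g (v k) := by
    intro k
    have h1 : ∑ j ∈ Finset.univ.erase k, (g (u j) - g (v j)) ≤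
        ∑ j ∈ Finset.univ.erase k, (2 : ℝ) := by
      refine Finset.sum_le_sum fun j _ => ?_
      have := abs_le.1 (hle _ (hu j).1)
      have := abs_le.1 (hle _ (hv j).1)
      linarith
    have h2 := Finset.add_sum_erase Finset.univ (fun j => g (u j) - g (v j)) (Finset.mem_univ k)
    have h3 := Finset.add_sum_erase Finset.univ (fun j : Fin n => (2 : ℝ)) (Finset.mem_univ k)
    simp only [Finset.sum_const, Finset.card_univ, Fintype.card_fin, nsmul_eq_mul] at h1 h2 h3
    linarith
  refine ⟨g, hg1, fun i => ⟨⟨u (e i), (hu _).1, ?_, ?_⟩, ⟨v (e i), (hv _).1, ?_, ?_⟩⟩⟩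
  · simpa using (hu (e i)).2
  · have := hk (e i)
    have := abs_le.1 (hle _ (hv (e i)).1)
    linarith
  · simpa using (hv (e i)).2
  · have := hk (e i)
    have := abs_le.1 (hle _ (hu (e i)).1)
    linarith

lemma sd2p_many {X : Type*} [NormedAddCommGroup X] [NormedSpace ℝ X] (hX : SD2P X) (m : ℕ) :
    ∀ {ι : Type} [Fintype ι] [Nonempty ι] (F : ι → X →L[ℝ] ℝ) (_ : ∀ i, F i ≠ 0)
    (ε : ℝ) (_ : 0 < ε),
    ∃ g : Fin m → X →L[ℝ] ℝ, (∀ k, ‖g k‖ ≤ 1) ∧ ∀ i, ∀ σ : Fin m → Bool,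
      ∃ x, ‖x‖ ≤ 1 ∧ F i x > ‖F i‖ - ε ∧ ∀ k, (if σ k then g k x else - g k x) > 1 - ε := by
  induction m with
  | zero =>
    intro ι _ _ F hF ε hε
    obtain ⟨g, hg, h⟩ := sd2p_step hX F hF ε hε
    refine ⟨fun _ => 0, by simp, fun i σ => ?_⟩
    obtain ⟨x, h1, h2, -⟩ := (h i).1
    exact ⟨x, h1, h2, fun k => k.elim0⟩
  | succ m ih =>
    intro ι _ _ F hF ε hε
    set δ := min ε (1/2) / 3 with hδ
    have hδ0 : 0 < δ := by have : 0 < min ε (1/2) := lt_min hε (by norm_num)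
                           positivity
    have hδ1 : 3 * δ ≤ ε := by have := min_le_left ε (1/2); linarith
    have hδ2 : 3 * δ ≤ 1 / 2 := by have := min_le_right ε (1/2); linarith
    obtain ⟨g, hg, h⟩ := sd2p_step hX F hF δ hδ0
    let G : ι × Bool → X →L[ℝ] ℝ := fun p => if p.2 then F p.1 + g else F p.1 - g
    have happ : ∀ (f : X →L[ℝ] ℝ) x, ‖x‖ ≤ 1 → |f x| ≤ ‖f‖ := by
      intro f x hx
      have := f.le_opNorm x
      rw [Real.norm_eq_abs] at this
      nlinarith [norm_nonneg x, norm_nonneg f]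
    have hG : ∀ p, ‖F p.1‖ + 1 - 2 * δ < ‖G p‖ := by
      rintro ⟨i, _ | _⟩
      · obtain ⟨x, h1, h2, h3⟩ := (h i).2
        have := (le_abs_self _).trans (happ (G (i, false)) x h1)
        simp [G] at this ⊢
        linarith
      · obtain ⟨x, h1, h2, h3⟩ := (h i).1
        have := (le_abs_self _).trans (happ (G (i, true)) x h1)
        simp [G] at this ⊢
        linarith
    have hG0 : ∀ p, G p ≠ 0 := by
      intro p
      have := hG p
      rw [← norm_pos_iff]
      linarith [norm_nonneg (F p.1)]
    obtain ⟨g', hg', h'⟩ := ih G hG0 δ hδ0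
    refine ⟨Fin.cons g g', ?_, ?_⟩
    · intro k
      refine Fin.cases ?_ (fun k => ?_) k
      · simpa using hg
      · simpa using hg' k
    · intro i σ
      obtain ⟨x, hx1, hx2, hx3⟩ := h' (i, σ 0) (fun k => σ k.succ)
      have h4 := hG (i, σ 0)
      have h5 := abs_le.1 (happ g x hx1)
      have h6 := abs_le.1 (happ (F i) x hx1)
      refine ⟨x, hx1, ?_, ?_⟩
      · cases hσ : σ 0 <;> simp [G, hσ] at hx2 h4 ⊢ <;> linarith
      · intro k
        refine Fin.cases ?_ (fun k => ?_) k
        · simp only [Fin.cons_zero]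
          cases hσ : σ 0 <;> simp [G, hσ] at hx2 h4 ⊢ <;> linarith
        · simp only [Fin.cons_succ]
          have := hx3 k
          linarith

lemma projNorm_tmul_le {X Y : Type*} [NormedAddCommGroup X] [NormedSpace ℝ X]
    [NormedAddCommGroup Y] [NormedSpace ℝ Y] (x : X) (y : Y) :
    projNorm X Y (x ⊗ₜ[ℝ] y) ≤ ‖x‖ * ‖y‖ := by
  refine csInf_le ⟨0, ?_⟩ ⟨1, fun _ => x, fun _ => y, by simp, by simp⟩
  rintro _ ⟨n, e, f, -, rfl⟩
  positivity

lemma le_projNorm {X Y : Type*} [NormedAddCommGroup X] [NormedSpace ℝ X]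
    [NormedAddCommGroup Y] [NormedSpace ℝ Y] (S : X ⊗[ℝ] Y →ₗ[ℝ] ℝ) (r : ℝ) (hr : 0 < r)
    (h : ∀ x y, S (x ⊗ₜ[ℝ] y) ≤ r * (‖x‖ * ‖y‖)) (u : X ⊗[ℝ] Y) : S u ≤ r * projNorm X Y u := by
  rw [← div_le_iff₀' hr]
  refine le_csInf ?_ ?_
  · obtain ⟨s, hs⟩ := TensorProduct.exists_finset u
    refine ⟨_, s.card, fun i => (s.equivFin.symm i).1.1, fun i => (s.equivFin.symm i).1.2, ?_, rfl⟩
    rw [s.equivFin.symm.sum_comp (fun p => p.1.1 ⊗ₜ[ℝ] p.1.2)]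
    rw [hs, ← Finset.sum_coe_sort]
  · rintro _ ⟨n, e, f, rfl, rfl⟩
    rw [div_le_iff₀' hr, map_sum, Finset.mul_sum]
    exact Finset.sum_le_sum fun i _ => h _ _

lemma exists_elem {X Y Z : Type*} [NormedAddCommGroup X] [NormedSpace ℝ X]
    [NormedAddCommGroup Y] [NormedSpace ℝ Y] [NormedAddCommGroup Z] [NormedSpace ℝ Z]
    (t : X →ₗ[ℝ] Y →ₗ[ℝ] Z) (hZ : IsProjectiveTensorProduct X Y Z t) (T : Z →L[ℝ] ℝ)
    (r : ℝ) (hr : 0 < r) (hrT : r < ‖T‖) :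
    ∃ x y, ‖x‖ ≤ 1 ∧ ‖y‖ = 1 ∧ r < T (t x y) := by
  by_contra! hcon
  have h1 : ∀ x y, T (t x y) ≤ r * (‖x‖ * ‖y‖) := by
    intro x y
    by_cases hx : x = 0
    · simp [hx]
    by_cases hy : y = 0
    · simp [hy]
    have hx' := norm_pos_iff.2 hx
    have hy' := norm_pos_iff.2 hy
    have := hcon (‖x‖⁻¹ • x) (‖y‖⁻¹ • y) (by rw [norm_smul]; simp [hx]) (by rw [norm_smul]; simp [hy])
    simp only [map_smul, LinearMap.smul_apply, smul_eq_mul] at this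
    rw [← mul_assoc, ← mul_inv, inv_mul_le_iff₀ (by positivity)] at this
    linarith
  have h2 : ∀ u, T (TensorProduct.lift t u) ≤ r * ‖TensorProduct.lift t u‖ := by
    intro u
    rw [hZ.2.2]
    exact le_projNorm (T.toLinearMap ∘ₗ TensorProduct.lift t) r hr (by simpa using h1) u
  have h3 : ∀ z, T z ≤ r * ‖z‖ := by
    intro z
    refine hZ.2.1.induction_on (p := fun z => T z ≤ r * ‖z‖) z ?_ h2
    exact isClosed_le T.continuous (by fun_prop)
  have h4 : ‖T‖ ≤ r := by
    refine T.opNorm_le_bound hr.le fun z => ?_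
    rw [Real.norm_eq_abs, abs_le]
    have := h3 (-z)
    simp at this
    exact ⟨by linarith, h3 z⟩
  linarith

/-- if `X` has the strong diameter two property and `Y` is a
two-dimensional real Banach space, then the projective tensor product `X ⊗_π Y`
(realized as a Banach space `Z`) has the strong diameter two property. -/
theorem stmt_14 (X : Type*) [NormedAddCommGroup X] [NormedSpace ℝ X] [CompleteSpace X]
    (hX : SD2P X)
    (Y : Type*) [NormedAddCommGroup Y] [NormedSpace ℝ Y]
    (hY : Module.finrank ℝ Y = 2)
    (Z : Type v) [NormedAddCommGroup Z] [NormedSpace ℝ Z] [CompleteSpace Z]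
    (t : X →ₗ[ℝ] Y →ₗ[ℝ] Z) (hZ : IsProjectiveTensorProduct X Y Z t) :
    SD2P Z := by
  intro n T a l hT ha hl hl1
  have hne : Nonempty (Fin n) := by
    by_contra h
    rw [not_nonempty_iff] at h
    simp at hl1
  have htn : ∀ x y, ‖t x y‖ ≤ ‖x‖ * ‖y‖ := by
    intro x y
    have := hZ.2.2 (x ⊗ₜ[ℝ] y)
    rw [TensorProduct.lift.tmul] at this
    rw [this]
    exact projNorm_tmul_le x y
  have hball : ∀ g : Fin n → Z, (∀ i, ‖g i‖ ≤ 1 ∧ T i (g i) > ‖T i‖ - a i) →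
      ‖∑ i, l i • g i‖ ≤ 1 := by
    intro g hg
    calc ‖∑ i, l i • g i‖ ≤ ∑ i, ‖l i • g i‖ := norm_sum_le _ _
      _ ≤ ∑ i, l i := by
        refine Finset.sum_le_sum fun i _ => ?_
        rw [norm_smul, Real.norm_of_nonneg (hl i)]
        exact mul_le_of_le_one_right (hl i) (hg i).1
      _ = 1 := hl1
  set W := {z : Z | ∃ g : Fin n → Z,
      (∀ i, ‖g i‖ ≤ 1 ∧ T i (g i) > ‖T i‖ - a i) ∧ z = ∑ i, l i • g i} with hW
  have hdist : ∀ z ∈ W, ∀ w ∈ W, dist z w ≤ 2 := by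
    rintro _ ⟨g, hg, rfl⟩ _ ⟨g', hg', rfl⟩
    rw [dist_eq_norm]
    have := norm_sub_le (∑ i, l i • g i) (∑ i, l i • g' i)
    linarith [hball g hg, hball g' hg']
  refine le_antisymm (Metric.diam_le_of_forall_dist_le (by norm_num) hdist) ?_
  have hbdd : Bornology.IsBounded W := Metric.isBounded_iff.2 ⟨2, fun z hz w hw => hdist z hz w hw⟩
  have hex : ∀ i, ∃ x y, ‖x‖ ≤ 1 ∧ ‖y‖ = 1 ∧ ‖T i‖ - min (a i) ‖T i‖ / 2 < T i (t x y) := by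
    intro i
    have hp : 0 < ‖T i‖ := norm_pos_iff.2 (hT i)
    have h1 : 0 < min (a i) ‖T i‖ := lt_min (ha i) hp
    have h2 : min (a i) ‖T i‖ ≤ ‖T i‖ := min_le_right _ _
    exact exists_elem t hZ (T i) _ (by linarith) (by linarith)
  choose x₀ y hx₀ hy hxy using hex
  let F : Fin n → X →L[ℝ] ℝ := fun i =>
    LinearMap.mkContinuous ((T i).toLinearMap ∘ₗ t.flip (y i)) (‖T i‖) (by
      intro x
      have h1 := (T i).le_opNorm (t x (y i))
      have h2 := htn x (y i)
      rw [hy, mul_one] at h2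
      exact h1.trans (mul_le_mul_of_nonneg_left h2 (norm_nonneg _)))
  have hFa : ∀ i x, F i x = T i (t x (y i)) := fun i x => rfl
  have hFn : ∀ i, ‖T i‖ - min (a i) ‖T i‖ / 2 < ‖F i‖ := by
    intro i
    have h1 := (F i).le_opNorm (x₀ i)
    have h2 := hxy i
    rw [← hFa] at h2
    have h3 := le_abs_self (F i (x₀ i))
    rw [Real.norm_eq_abs] at h1
    nlinarith [norm_nonneg (F i), hx₀ i]
  have hF0 : ∀ i, F i ≠ 0 := by
    intro i
    rw [← norm_pos_iff]
    have h2 : min (a i) ‖T i‖ ≤ ‖T i‖ := min_le_right _ _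
    linarith [hFn i, norm_pos_iff.2 (hT i)]
  have hsup : ∀ i, ∃ f : Y →L[ℝ] ℝ, ‖f‖ ≤ 1 ∧ f (y i) = 1 := by
    intro i
    obtain ⟨f, h1, h2⟩ := exists_dual_vector'' ℝ (y i)
    exact ⟨f, h1, by rw [h2, hy]; simp⟩
  choose f hf1 hf2 using hsup
  obtain ⟨m, φ, hφ⟩ := zonotope_dual hY (fun i => (f i).toLinearMap)
  have hφle : ∀ v, ∑ k, |φ k v| ≤ ‖v‖ := by
    intro v
    obtain ⟨i, hi⟩ := (hφ v).2
    rw [hi]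
    have := (f i).le_opNorm v
    rw [Real.norm_eq_abs] at this
    exact this.trans (mul_le_of_le_one_left (norm_nonneg _) (hf1 i))
  have hφge : ∀ i, 1 ≤ ∑ k, |φ k (y i)| := by
    intro i
    have := (hφ (y i)).1 i
    simpa [hf2] using this
  refine le_of_forall_pos_sub_le fun η hη => ?_
  obtain ⟨i₁, hi₁⟩ := Finite.exists_min a
  set ε := min (min (η / 2) (a i₁ / 2)) 1 with hε
  have hε0 : 0 < ε := lt_min (lt_min (by linarith) (by linarith [ha i₁])) one_pos
  have hε1 : ε ≤ η / 2 := (min_le_left _ _).trans (min_le_left _ _)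
  have hε2 : ∀ i, ε ≤ a i / 2 := fun i => by
    have : ε ≤ a i₁ / 2 := (min_le_left _ _).trans (min_le_right _ _)
    have := hi₁ i
    linarith
  have hε3 : ε ≤ 1 := min_le_right _ _
  obtain ⟨g, hg, hgx⟩ := sd2p_many hX m F hF0 ε hε0
  choose u hu1 hu2 hu3 using fun i => hgx i (fun k => decide (0 ≤ φ k (y i)))
  choose w hw1 hw2 hw3 using fun i => hgx i (fun k => decide (¬ 0 ≤ φ k (y i)))
  have hmem : ∀ u : Fin n → X, (∀ i, ‖u i‖ ≤ 1) → (∀ i, F i (u i) > ‖F i‖ - ε) →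
      (∑ i, l i • t (u i) (y i)) ∈ W := by
    intro u h1 h2
    refine ⟨fun i => t (u i) (y i), fun i => ⟨?_, ?_⟩, rfl⟩
    · have := htn (u i) (y i)
      rw [hy, mul_one] at this
      exact this.trans (h1 i)
    · have h3 := h2 i
      rw [hFa] at h3
      have h4 : min (a i) ‖T i‖ ≤ a i := min_le_left _ _
      linarith [hFn i, hε2 i]
  refine le_trans ?_ (Metric.dist_le_diam_of_mem hbdd (hmem u hu1 hu2) (hmem w hw1 hw2))
  let S : X ⊗[ℝ] Y →ₗ[ℝ] ℝ := TensorProduct.lift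
    (∑ k, (LinearMap.mul ℝ ℝ).compl₁₂ (g k).toLinearMap (φ k))
  have hS : ∀ x v, S (x ⊗ₜ[ℝ] v) = ∑ k, g k x * φ k v := by
    intro x v
    simp [S, LinearMap.sum_apply]
  have hSle : ∀ x v, S (x ⊗ₜ[ℝ] v) ≤ 1 * (‖x‖ * ‖v‖) := by
    intro x v
    rw [hS, one_mul]
    calc ∑ k, g k x * φ k v ≤ ∑ k, ‖x‖ * |φ k v| := by
          refine Finset.sum_le_sum fun k _ => ?_
          refine (le_abs_self _).trans ?_
          rw [abs_mul]
          refine mul_le_mul_of_nonneg_right ?_ (abs_nonneg _)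
          have := (g k).le_opNorm x
          rw [Real.norm_eq_abs] at this
          exact this.trans (mul_le_of_le_one_left (norm_nonneg _) (hg k))
      _ ≤ ‖x‖ * ‖v‖ := by
          rw [← Finset.mul_sum]
          exact mul_le_mul_of_nonneg_left (hφle v) (norm_nonneg _)
  have hkey := le_projNorm S 1 one_pos hSle (∑ i, l i • ((u i - w i) ⊗ₜ[ℝ] y i))
  rw [← hZ.2.2, one_mul] at hkey
  have e1 : TensorProduct.lift t (∑ i, l i • ((u i - w i) ⊗ₜ[ℝ] y i)) =
      (∑ i, l i • t (u i) (y i)) - ∑ i, l i • t (w i) (y i) := by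
    simp [map_sum, smul_sub, Finset.sum_sub_distrib]
  rw [e1] at hkey
  rw [dist_eq_norm]
  refine le_trans ?_ hkey
  rw [map_sum]
  have hterm : ∀ i, 2 - η ≤ S ((u i - w i) ⊗ₜ[ℝ] y i) := by
    intro i
    rw [hS]
    have h1 : ∑ k, (2 - η) * |φ k (y i)| ≤ ∑ k, g k (u i - w i) * φ k (y i) := by
      refine Finset.sum_le_sum fun k _ => ?_
      have h2 := hu3 i k
      have h3 := hw3 i k
      rw [map_sub]
      by_cases h : 0 ≤ φ k (y i)
      · simp only [h, decide_true, if_true, not_true, decide_false] at h2 h3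
        simp at h3
        rw [abs_of_nonneg h]
        refine mul_le_mul_of_nonneg_right ?_ h
        linarith
      · simp only [h, decide_false, not_false_eq_true, decide_true, if_true] at h2 h3
        simp at h2
        rw [abs_of_neg (not_le.1 h)]
        nlinarith [not_le.1 h]
    rw [← Finset.mul_sum] at h1
    rcases le_total 0 (2 - η) with h4 | h4
    · nlinarith [hφge i]
    · have h5 := hφle (y i)
      rw [hy] at h5
      nlinarith
  calc 2 - η = ∑ i, l i * (2 - η) := by rw [← Finset.sum_mul, hl1, one_mul]
    _ ≤ ∑ i, S (l i • ((u i - w i) ⊗ₜ[ℝ] y i)) := by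
      refine Finset.sum_le_sum fun i _ => ?_
      rw [map_smul, smul_eq_mul]
      exact mul_le_mul_of_nonneg_left (hterm i) (hl i)
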